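/- Let k ≥ 1 be an integer and ν, μ nonzero reals. Let a₀, a₁ : ℝ² → ℝ be continuous with a₀(x,y) = O(√(x²+y²)) and a₁(x,y) = O(√(x²+y²)) as (x,y) → 0, and let b₀ : ℝ → ℝ be continuous with b₀(y) = O(y^{k+1}) as y → 0. Define F(x,y) = (x(ν + a₁(x,y)))² + ((μ/k!) y^k + x a₀(x,y) + b₀(y))². Then F(x,y) / (ν² x² + (μ/k!)² y^{2k}) → 1 as (x,y) → (0,0) with (x,y) ≠ (0,0). -/

import Mathlib

open Asymptotics Filter Topology

theorem Asymptotics.isEquivalent_sq_add_sq {α : Type*} {l : Filter α} {X Y e f : α → ℝ}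
    (he : e =o[l] fun p => √(X p ^ 2 + Y p ^ 2)) (hf : f =o[l] fun p => √(X p ^ 2 + Y p ^ 2)) :
    (fun p => (X p + e p) ^ 2 + (Y p + f p) ^ 2) ~[l] fun p => X p ^ 2 + Y p ^ 2 := by
  have hX : X =O[l] fun p => √(X p ^ 2 + Y p ^ 2) := .of_norm_le fun p => by
    rw [Real.norm_eq_abs]
    exact Real.abs_le_sqrt (by nlinarith [sq_nonneg (Y p)])
  have hY : Y =O[l] fun p => √(X p ^ 2 + Y p ^ 2) := .of_norm_le fun p => by
    rw [Real.norm_eq_abs]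
    exact Real.abs_le_sqrt (by nlinarith [sq_nonneg (X p)])
  have h1 := ((hX.const_mul_left 2).add he.isBigO).mul_isLittleO he
  have h2 := ((hY.const_mul_left 2).add hf.isBigO).mul_isLittleO hf
  refine (h1.add h2).congr (fun p => ?_) (fun p => ?_)
  · simp only [Pi.sub_apply]
    ring
  · exact Real.mul_self_sqrt (by positivity)

theorem stmt5 (k : ℕ) (hk : 1 ≤ k) (ν μ : ℝ) (hν : ν ≠ 0) (hμ : μ ≠ 0)
    (a₀ a₁ : ℝ × ℝ → ℝ) (b₀ : ℝ → ℝ)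
    (ha₀c : Continuous a₀) (ha₁c : Continuous a₁) (hb₀c : Continuous b₀)
    (ha₀ : a₀ =O[𝓝 (0 : ℝ × ℝ)] fun p : ℝ × ℝ => Real.sqrt (p.1^2 + p.2^2))
    (ha₁ : a₁ =O[𝓝 (0 : ℝ × ℝ)] fun p : ℝ × ℝ => Real.sqrt (p.1^2 + p.2^2))
    (hb₀ : b₀ =O[𝓝 (0:ℝ)] fun y : ℝ => y^(k+1)) :
    Tendsto (fun p : ℝ × ℝ =>
      ((p.1 * (ν + a₁ p))^2 + (μ / k.factorial * p.2^k + p.1 * a₀ p + b₀ p.2)^2) /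
        (ν^2 * p.1^2 + (μ / k.factorial)^2 * p.2^(2*k)))
      (𝓝[≠] (0 : ℝ × ℝ)) (𝓝 1) := by
  have hc : μ / k.factorial ≠ 0 := div_ne_zero hμ (by positivity)
  generalize μ / (k.factorial : ℝ) = c at hc ⊢
  have small {a : ℝ × ℝ → ℝ}
      (ha : a =O[𝓝 (0 : ℝ × ℝ)] fun p : ℝ × ℝ => Real.sqrt (p.1^2 + p.2^2)) :
      a =o[𝓝 (0 : ℝ × ℝ)] fun _ => (1 : ℝ) := by
    rw [isLittleO_one_iff]
    refine ha.trans_tendsto ?_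
    have : Continuous fun p : ℝ × ℝ => Real.sqrt (p.1^2 + p.2^2) := by fun_prop
    simpa using this.tendsto 0
  have hx : (fun p : ℝ × ℝ => p.1) =O[𝓝 0] fun p => √((ν * p.1) ^ 2 + (c * p.2 ^ k) ^ 2) := by
    refine (isBigO_const_mul_left_iff hν).1 (.of_norm_le fun p => ?_)
    rw [Real.norm_eq_abs]
    exact Real.abs_le_sqrt (by nlinarith [sq_nonneg (c * p.2 ^ k)])
  have hy : (fun p : ℝ × ℝ => p.2 ^ k) =O[𝓝 0]
      fun p => √((ν * p.1) ^ 2 + (c * p.2 ^ k) ^ 2) := by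
    refine (isBigO_const_mul_left_iff hc).1 (.of_norm_le fun p => ?_)
    rw [Real.norm_eq_abs]
    exact Real.abs_le_sqrt (by nlinarith [sq_nonneg (ν * p.1)])
  have hsnd : Tendsto (fun p : ℝ × ℝ => p.2) (𝓝 0) (𝓝 0) := continuous_snd.tendsto 0
  have hb : (fun p : ℝ × ℝ => b₀ p.2) =o[𝓝 0]
      fun p => √((ν * p.1) ^ 2 + (c * p.2 ^ k) ^ 2) := by
    refine (hb₀.comp_tendsto hsnd).trans_isLittleO ?_
    simpa [Function.comp_def, pow_succ] using
      hy.mul_isLittleO ((isLittleO_one_iff ℝ).2 hsnd)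
  have he : (fun p : ℝ × ℝ => p.1 * a₁ p) =o[𝓝 0]
      fun p => √((ν * p.1) ^ 2 + (c * p.2 ^ k) ^ 2) := by
    simpa using hx.mul_isLittleO (small ha₁)
  have hf : (fun p : ℝ × ℝ => p.1 * a₀ p + b₀ p.2) =o[𝓝 0]
      fun p => √((ν * p.1) ^ 2 + (c * p.2 ^ k) ^ 2) :=
    .add (by simpa using hx.mul_isLittleO (small ha₀)) hb
  have hne : ∀ᶠ p : ℝ × ℝ in 𝓝[≠] 0, (ν * p.1) ^ 2 + (c * p.2 ^ k) ^ 2 ≠ 0 := by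
    filter_upwards [self_mem_nhdsWithin] with p hp h
    have h1 : ν * p.1 = 0 := by nlinarith [sq_nonneg (ν * p.1), sq_nonneg (c * p.2 ^ k)]
    have h2 : c * p.2 ^ k = 0 := by nlinarith [sq_nonneg (ν * p.1), sq_nonneg (c * p.2 ^ k)]
    exact hp (Prod.ext ((mul_eq_zero_iff_left hν).1 h1)
      (eq_zero_of_pow_eq_zero ((mul_eq_zero_iff_left hc).1 h2)))
  have key := (isEquivalent_iff_tendsto_one hne).1
    ((isEquivalent_sq_add_sq he hf).mono nhdsWithin_le_nhds)
  refine key.congr fun p => ?_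
  simp only [Pi.div_apply]
  congr 1 <;> ring
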